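/- arXiv:2507.01207 — 5 statements merged into one kernel-verified Lean document; each statement's English description precedes it below -/
import Mathlib

section
/- Let X be a separable real Hilbert space, Y a real Hilbert space, M ⊆ X nonempty, and F : M → Y continuous and weakly sequentially closed. Let a₀ ∈ X and I₁ ∈ Y, and assume there exists an a₀-minimum-norm solution of F(a) = I₁. Let (δₖ) and (αₖ) be sequences of positive reals with δₖ → 0, αₖ → 0, and δₖ²/αₖ → 0 as k → ∞; let I₁^{δₖ} ∈ Y satisfy ‖I₁ − I₁^{δₖ}‖_Y ≤ δₖ; and let aₖ ∈ M minimize a ↦ ‖F(a) − I₁^{δₖ}‖_Y² + αₖ‖a − a₀‖_X² over M. Then the sequence (aₖ) has a subsequence converging in the norm of X, and the limit of every norm-convergent subsequence of (aₖ) is an a₀-minimum-norm solution of F(a) = I₁. -/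
open Filter Topology RealInnerProductSpace

/-- A norm-bounded sequence in a separable Hilbert space has a weakly convergent subsequence. -/
theorem exists_subseq_tendsto_inner_of_norm_le {X : Type*} [NormedAddCommGroup X]
    [InnerProductSpace ℝ X] [CompleteSpace X] [TopologicalSpace.SeparableSpace X]
    {u : ℕ → X} {C : ℝ} (hu : ∀ n, ‖u n‖ ≤ C) :
    ∃ φ : ℕ → ℕ, StrictMono φ ∧ ∃ x : X,
      ∀ z : X, Tendsto (fun n => ⟪u (φ n), z⟫) atTop (𝓝 ⟪x, z⟫) := by
  let D := InnerProductSpace.toDual ℝ X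
  have hmem (n : ℕ) : StrongDual.toWeakDual (D (u n)) ∈
      WeakDual.toStrongDual ⁻¹' Metric.closedBall (0 : StrongDual ℝ X) C := by
    simpa [D] using hu n
  obtain ⟨ℓ, -, φ, hφ, hlim⟩ := WeakDual.isSeqCompact_closedBall (𝕜 := ℝ) (E := X) 0 C hmem
  refine ⟨φ, hφ, D.symm (WeakDual.toStrongDual ℓ), fun z => ?_⟩
  rw [InnerProductSpace.toDual_symm_apply]
  exact ((WeakDual.eval_continuous z).tendsto ℓ).comp hlim

/-- Convergence of Tikhonov regularization (IIM, restricted noise case):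
for `F : M → Y` continuous and weakly sequentially closed on `M ⊆ X` (X a separable real
Hilbert space), noisy data `I₁^{δₖ}` with `δₖ → 0`, and regularization parameters `αₖ → 0`
with `δₖ²/αₖ → 0`, any sequence of Tikhonov minimizers `aₖ` has a norm-convergent
subsequence, and every limit of a norm-convergent subsequence is an `a₀`-minimum-norm
solution of `F(a) = I₁`. -/
theorem iim_tikhonov_convergence_restricted_noise
    {X Y : Type*}
    [NormedAddCommGroup X] [InnerProductSpace ℝ X] [CompleteSpace X]
    [TopologicalSpace.SeparableSpace X]
    [NormedAddCommGroup Y] [InnerProductSpace ℝ Y] [CompleteSpace Y]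
    (M : Set X) (hM : M.Nonempty)
    (F : X → Y) (hFcont : ContinuousOn F M)
    (hFwsc : ∀ (b : ℕ → X), (∀ n, b n ∈ M) → ∀ (x : X) (y : Y),
      (∀ z : X, Tendsto (fun n => ⟪b n, z⟫) atTop (𝓝 ⟪x, z⟫)) →
      (∀ z : Y, Tendsto (fun n => ⟪F (b n), z⟫) atTop (𝓝 ⟪y, z⟫)) →
      x ∈ M ∧ F x = y)
    (a₀ : X) (I₁ : Y)
    (hMNSexists : ∃ adag ∈ M, F adag = I₁ ∧
      ∀ b ∈ M, F b = I₁ → ‖adag - a₀‖ ≤ ‖b - a₀‖)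
    (δ α : ℕ → ℝ) (hδpos : ∀ k, 0 < δ k) (hαpos : ∀ k, 0 < α k)
    (hδ0 : Tendsto δ atTop (𝓝 0)) (hα0 : Tendsto α atTop (𝓝 0))
    (hratio : Tendsto (fun k => (δ k) ^ 2 / α k) atTop (𝓝 0))
    (I₁δ : ℕ → Y) (hnoise : ∀ k, ‖I₁ - I₁δ k‖ ≤ δ k)
    (a : ℕ → X) (hamem : ∀ k, a k ∈ M)
    (hmin : ∀ k, ∀ b ∈ M,
      ‖F (a k) - I₁δ k‖ ^ 2 + α k * ‖a k - a₀‖ ^ 2 ≤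
        ‖F b - I₁δ k‖ ^ 2 + α k * ‖b - a₀‖ ^ 2) :
    (∃ φ : ℕ → ℕ, StrictMono φ ∧ ∃ alim : X,
      Tendsto (fun k => a (φ k)) atTop (𝓝 alim)) ∧
    (∀ φ : ℕ → ℕ, StrictMono φ → ∀ alim : X,
      Tendsto (fun k => a (φ k)) atTop (𝓝 alim) →
      alim ∈ M ∧ F alim = I₁ ∧ ∀ b ∈ M, F b = I₁ → ‖alim - a₀‖ ≤ ‖b - a₀‖) := by
  obtain ⟨adag, hadagM, hFadag, hadag_min⟩ := hMNSexists
  have hdata_le (k : ℕ) : ‖F (a k) - I₁δ k‖ ^ 2 + α k * ‖a k - a₀‖ ^ 2 ≤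
      δ k ^ 2 + α k * ‖adag - a₀‖ ^ 2 := by
    have h := hmin k adag hadagM
    rw [hFadag] at h
    have := pow_le_pow_left₀ (norm_nonneg _) (hnoise k) 2
    linarith
  have hnorm_le (k : ℕ) : ‖a k - a₀‖ ^ 2 ≤ δ k ^ 2 / α k + ‖adag - a₀‖ ^ 2 := by
    have hα := hαpos k
    rw [div_add' _ _ _ hα.ne', le_div_iff₀ hα]
    nlinarith [hdata_le k, sq_nonneg ‖F (a k) - I₁δ k‖]
  have hbound_lim : Tendsto (fun k => δ k ^ 2 / α k + ‖adag - a₀‖ ^ 2) atTop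
      (𝓝 (‖adag - a₀‖ ^ 2)) := by
    simpa using hratio.add_const (‖adag - a₀‖ ^ 2)
  have hresidual : Tendsto (fun k => F (a k) - I₁δ k) atTop (𝓝 0) := by
    rw [tendsto_zero_iff_norm_tendsto_zero]
    have hsq : Tendsto (fun k => ‖F (a k) - I₁δ k‖ ^ 2) atTop (𝓝 0) := by
      refine squeeze_zero (g := fun k => δ k ^ 2 + α k * ‖adag - a₀‖ ^ 2)
        (fun k => sq_nonneg _) (fun k => ?_) ?_
      · nlinarith [hdata_le k, mul_nonneg (hαpos k).le (sq_nonneg ‖a k - a₀‖)]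
      · simpa using (hδ0.pow 2).add (hα0.mul_const (‖adag - a₀‖ ^ 2))
    simpa [Real.sqrt_sq (norm_nonneg _)] using hsq.sqrt
  have hdata : Tendsto I₁δ atTop (𝓝 I₁) := by
    rw [tendsto_iff_norm_sub_tendsto_zero]
    exact squeeze_zero (fun _ => norm_nonneg _)
      (fun k => by rw [norm_sub_rev]; exact hnoise k) hδ0
  have hF : Tendsto (fun k => F (a k)) atTop (𝓝 I₁) := by
    simpa using hresidual.add hdata
  have hweak_limit {φ : ℕ → ℕ} (hφ : StrictMono φ) {x : X}
      (hx : ∀ z : X, Tendsto (fun n => ⟪a (φ n), z⟫) atTop (𝓝 ⟪x, z⟫)) :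
      x ∈ M ∧ F x = I₁ :=
    hFwsc (fun n => a (φ n)) (fun n => hamem _) x I₁ hx fun z =>
      (hF.comp hφ.tendsto_atTop).inner tendsto_const_nhds
  constructor
  · obtain ⟨B, hB⟩ := hbound_lim.bddAbove_range
    have hbdd (k : ℕ) : ‖a k‖ ≤ √B + ‖a₀‖ := by
      have h : ‖a k - a₀‖ ≤ √B := Real.le_sqrt_of_sq_le ((hnorm_le k).trans (hB ⟨k, rfl⟩))
      linarith [norm_le_norm_sub_add (a k) a₀]
    obtain ⟨φ, hφ, x, hx⟩ := exists_subseq_tendsto_inner_of_norm_le hbdd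
    obtain ⟨hxM, hFx⟩ := hweak_limit hφ hx
    have hdist : ‖adag - a₀‖ ^ 2 ≤ ‖x - a₀‖ ^ 2 :=
      pow_le_pow_left₀ (norm_nonneg _) (hadag_min x hxM hFx) 2
    refine ⟨φ, hφ, x, ?_⟩
    have hinner : Tendsto (fun k => ⟪a (φ k) - a₀, x - a₀⟫) atTop (𝓝 (‖x - a₀‖ ^ 2)) := by
      simpa only [← inner_sub_left, real_inner_self_eq_norm_sq] using
        (hx (x - a₀)).sub_const ⟪a₀, x - a₀⟫
    have hupper : Tendsto (fun k => (δ (φ k) ^ 2 / α (φ k) + ‖x - a₀‖ ^ 2)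
        - 2 * ⟪a (φ k) - a₀, x - a₀⟫ + ‖x - a₀‖ ^ 2) atTop (𝓝 0) := by
      have h := (((hratio.comp hφ.tendsto_atTop).add_const (‖x - a₀‖ ^ 2)).sub
        (hinner.const_mul 2)).add_const (‖x - a₀‖ ^ 2)
      rwa [show 0 + ‖x - a₀‖ ^ 2 - 2 * ‖x - a₀‖ ^ 2 + ‖x - a₀‖ ^ 2 = 0 by ring] at h
    have hsq : Tendsto (fun k => ‖a (φ k) - x‖ ^ 2) atTop (𝓝 0) := by
      refine squeeze_zero (fun _ => sq_nonneg _) (fun k => ?_) hupper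
      rw [← sub_sub_sub_cancel_right (a (φ k)) x a₀, norm_sub_sq_real]
      linarith [hnorm_le (φ k)]
    rw [tendsto_iff_norm_sub_tendsto_zero]
    simpa [Real.sqrt_sq (norm_nonneg _)] using hsq.sqrt
  · intro φ hφ x hx
    obtain ⟨hxM, hFx⟩ := hweak_limit hφ fun z => hx.inner tendsto_const_nhds
    refine ⟨hxM, hFx, fun b hb hFb => le_trans ?_ (hadag_min b hb hFb)⟩
    exact le_of_sq_le_sq (le_of_tendsto_of_tendsto' ((hx.sub_const a₀).norm.pow 2)
      (hbound_lim.comp hφ.tendsto_atTop) fun k => hnorm_le (φ k)) (norm_nonneg _)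
end

section
/- Let X and Y be real Hilbert spaces, M ⊆ X nonempty closed and convex, and F : X → Y continuously Fréchet differentiable. Let a₀ ∈ X, I₁ ∈ Y, and let a† ∈ M be an a₀-minimum-norm solution of F(a) = I₁. Suppose there are ε > 2‖a† − a₀‖ and C > 0 such that ‖F′(a†) − F′(a)‖_{op} ≤ C‖a† − a‖ for all a ∈ M with ‖a − a†‖ ≤ ε, and suppose there exists w ∈ Y with a† − a₀ = F′(a†)* w (Hilbert-space adjoint) and C‖w‖ < 1. Then there exist K > 0 and δ₀ > 0 such that for every δ ∈ (0, δ₀], every I₁^δ ∈ Y with ‖I₁ − I₁^δ‖ ≤ δ, and every minimizer a_δ ∈ M of a ↦ ‖F(a) − I₁^δ‖² + δ‖a − a₀‖² over M (regularization parameter α = δ), one has ‖a_δ − a†‖ ≤ K√δ and ‖F(a_δ) − I₁^δ‖ ≤ Kδ. -/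
/-- Quadratic Taylor remainder bound when the derivative is Lipschitz relative to the base point `x`
along the segment from `x` to `x + d`. -/
theorem norm_taylor_remainder_le_of_lipschitz_segment
    {E G : Type*} [NormedAddCommGroup E] [NormedSpace ℝ E]
    [NormedAddCommGroup G] [NormedSpace ℝ G]
    {f : E → G} {f' : E → E →L[ℝ] G} {x d : E} {C : ℝ}
    (hf : ∀ t ∈ Set.Icc (0 : ℝ) 1, HasFDerivAt f (f' (x + t • d)) (x + t • d))
    (hlip : ∀ t ∈ Set.Icc (0 : ℝ) 1, ‖f' x - f' (x + t • d)‖ ≤ C * ‖t • d‖) :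
    ‖f (x + d) - f x - f' x d‖ ≤ C / 2 * ‖d‖ ^ 2 := by
  have hg : ∀ t ∈ Set.Icc (0 : ℝ) 1, HasDerivAt (fun t : ℝ => f (x + t • d) - f x - t • f' x d)
      (f' (x + t • d) d - f' x d) t := by
    intro t ht
    have hline : HasDerivAt (fun t : ℝ => x + t • d) d t := by
      simpa using ((hasDerivAt_id t).smul_const d).const_add x
    have hlin : HasDerivAt (fun t : ℝ => t • f' x d) (f' x d) t := by
      simpa using (hasDerivAt_id t).smul_const (f' x d)
    exact (((hf t ht).comp_hasDerivAt t hline).sub_const (f x)).sub hlin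
  have hB : ∀ t : ℝ, HasDerivAt (fun t : ℝ => C / 2 * ‖d‖ ^ 2 * t ^ 2) (C * ‖d‖ ^ 2 * t) t := by
    intro t
    refine ((hasDerivAt_pow 2 t).const_mul (C / 2 * ‖d‖ ^ 2)).congr_deriv ?_
    push_cast
    ring
  have key := image_norm_le_of_norm_deriv_right_le_deriv_boundary
    (f := fun t : ℝ => f (x + t • d) - f x - t • f' x d)
    (fun t ht => (hg t ht).continuousAt.continuousWithinAt)
    (fun t ht => (hg t (Set.Ico_subset_Icc_self ht)).hasDerivWithinAt)
    (by simp) hB ?_ (Set.right_mem_Icc.2 zero_le_one)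
  · simpa using key
  · intro t ht
    have ht' := Set.Ico_subset_Icc_self ht
    calc ‖f' (x + t • d) d - f' x d‖ = ‖(f' x - f' (x + t • d)) d‖ := by
          rw [sub_apply, norm_sub_rev]
      _ ≤ C * ‖t • d‖ * ‖d‖ := ContinuousLinearMap.le_of_opNorm_le _ (hlip t ht') d
      _ = C * ‖d‖ ^ 2 * t := by
          rw [norm_smul, Real.norm_of_nonneg ht'.1]
          ring


/-- Convergence rates for Tikhonov regularization (IIM, restricted noise case):
under the source condition `a† - a₀ = F'(a†)* w` with `C‖w‖ < 1` and a Lipschitz bound on the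
Fréchet derivative near `a†`, minimizers with parameter choice `α = δ` satisfy
`‖a_δ - a†‖ = O(√δ)` and `‖F(a_δ) - I₁^δ‖ = O(δ)`. -/
theorem iim_tikhonov_rates_restricted_noise
    {X Y : Type*}
    [NormedAddCommGroup X] [InnerProductSpace ℝ X] [CompleteSpace X]
    [NormedAddCommGroup Y] [InnerProductSpace ℝ Y] [CompleteSpace Y]
    (M : Set X) (hM : M.Nonempty) (hMclosed : IsClosed M) (hMconvex : Convex ℝ M)
    (F : X → Y) (F' : X → X →L[ℝ] Y)
    (hFderiv : ∀ x, HasFDerivAt F (F' x) x) (hF'cont : Continuous F')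
    (a₀ : X) (I₁ : Y) (adag : X)
    (hadagmem : adag ∈ M) (hsol : F adag = I₁)
    (hMNS : ∀ b ∈ M, F b = I₁ → ‖adag - a₀‖ ≤ ‖b - a₀‖)
    (ε C : ℝ) (hε : 2 * ‖adag - a₀‖ < ε) (hC : 0 < C)
    (hLip : ∀ b ∈ M, ‖b - adag‖ ≤ ε → ‖F' adag - F' b‖ ≤ C * ‖adag - b‖)
    (w : Y) (hsource : adag - a₀ = (F' adag).adjoint w) (hsmall : C * ‖w‖ < 1) :
    ∃ K > 0, ∃ δ₀ > 0, ∀ δ : ℝ, 0 < δ → δ ≤ δ₀ →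
      ∀ I₁δ : Y, ‖I₁ - I₁δ‖ ≤ δ →
      ∀ aδ ∈ M,
        (∀ b ∈ M, ‖F aδ - I₁δ‖ ^ 2 + δ * ‖aδ - a₀‖ ^ 2 ≤
          ‖F b - I₁δ‖ ^ 2 + δ * ‖b - a₀‖ ^ 2) →
        ‖aδ - adag‖ ≤ K * Real.sqrt δ ∧ ‖F aδ - I₁δ‖ ≤ K * δ := by
  have hw : 0 ≤ ‖w‖ := norm_nonneg w
  have hρ : 0 ≤ ‖adag - a₀‖ := norm_nonneg _
  have hgap : 0 < 1 - C * ‖w‖ := by linarith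
  have hs : 0 < Real.sqrt (1 - C * ‖w‖) := Real.sqrt_pos.2 hgap
  have hq : 0 ≤ (1 + ‖w‖) / Real.sqrt (1 - C * ‖w‖) := by positivity
  refine ⟨1 + 2 * ‖w‖ + (1 + ‖w‖) / Real.sqrt (1 - C * ‖w‖), by positivity,
    ε * (ε - 2 * ‖adag - a₀‖), mul_pos (by linarith) (by linarith), ?_⟩
  intro δ hδ hδ₀ I₁δ hnoise aδ haδ hmin
  have hmin' : ‖F aδ - I₁δ‖ ^ 2 + δ * ‖aδ - a₀‖ ^ 2 ≤ δ ^ 2 + δ * ‖adag - a₀‖ ^ 2 := by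
    have h := hmin adag hadagmem
    rw [hsol] at h
    have := pow_le_pow_left₀ (norm_nonneg _) hnoise 2
    linarith
  have hball : ‖aδ - adag‖ ≤ ε := by
    have h1 : ‖aδ - a₀‖ ^ 2 ≤ δ + ‖adag - a₀‖ ^ 2 := by
      refine le_of_mul_le_mul_left ?_ hδ
      nlinarith [sq_nonneg ‖F aδ - I₁δ‖]
    have h2 : ‖aδ - a₀‖ ≤ ε - ‖adag - a₀‖ :=
      le_of_sq_le_sq (by nlinarith) (by linarith)
    have h3 := norm_sub_le_norm_sub_add_norm_sub aδ a₀ adag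
    rw [norm_sub_rev a₀ adag] at h3
    linarith
  have htaylor : ‖F aδ - I₁ - F' adag (aδ - adag)‖ ≤ C / 2 * ‖aδ - adag‖ ^ 2 := by
    have h := norm_taylor_remainder_le_of_lipschitz_segment (f := F) (f' := F') (x := adag)
      (d := aδ - adag) (C := C) (fun t _ => hFderiv _) ?_
    · rwa [add_sub_cancel, hsol] at h
    · intro t ht
      have h := hLip (adag + t • (aδ - adag)) (hMconvex.add_smul_sub_mem hadagmem haδ ht) ?_
      · rwa [sub_add_cancel_left, norm_neg] at h
      · rw [add_sub_cancel_left, norm_smul, Real.norm_of_nonneg ht.1]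
        exact (mul_le_of_le_one_left (norm_nonneg _) ht.2).trans hball
  have hexpand : ‖aδ - a₀‖ ^ 2 = ‖aδ - adag‖ ^ 2 + 2 * inner ℝ (F' adag (aδ - adag)) w
      + ‖adag - a₀‖ ^ 2 := by
    rw [← ContinuousLinearMap.adjoint_inner_right, ← hsource, ← norm_add_sq_real,
      sub_add_sub_cancel]
  have hinner : -inner ℝ (F' adag (aδ - adag)) w ≤
      (‖F aδ - I₁δ‖ + δ + C / 2 * ‖aδ - adag‖ ^ 2) * ‖w‖ := by
    refine (neg_le_abs _).trans ((abs_real_inner_le_norm _ _).trans ?_)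
    refine mul_le_mul_of_nonneg_right ?_ hw
    have hdecomp : F' adag (aδ - adag) =
        (F aδ - I₁δ) - (I₁ - I₁δ) - (F aδ - I₁ - F' adag (aδ - adag)) := by abel
    rw [hdecomp]
    have h1 := norm_sub_le ((F aδ - I₁δ) - (I₁ - I₁δ)) (F aδ - I₁ - F' adag (aδ - adag))
    have h2 := norm_sub_le (F aδ - I₁δ) (I₁ - I₁δ)
    linarith
  have hmain : (‖F aδ - I₁δ‖ - δ * ‖w‖) ^ 2 + δ * ((1 - C * ‖w‖) * ‖aδ - adag‖ ^ 2) ≤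
      (δ * (1 + ‖w‖)) ^ 2 := by
    rw [hexpand] at hmin'
    have := mul_le_mul_of_nonneg_left hinner hδ.le
    linarith
  constructor
  · have h1 : (1 - C * ‖w‖) * ‖aδ - adag‖ ^ 2 ≤ (1 + ‖w‖) ^ 2 * δ := by
      refine le_of_mul_le_mul_left ?_ hδ
      linarith [sq_nonneg (‖F aδ - I₁δ‖ - δ * ‖w‖)]
    have h2 : Real.sqrt (1 - C * ‖w‖) * ‖aδ - adag‖ ≤ (1 + ‖w‖) * Real.sqrt δ := by
      refine le_of_sq_le_sq ?_ (by positivity)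
      rwa [mul_pow, mul_pow, Real.sq_sqrt hgap.le, Real.sq_sqrt hδ.le]
    have h3 : ‖aδ - adag‖ ≤ (1 + ‖w‖) / Real.sqrt (1 - C * ‖w‖) * Real.sqrt δ := by
      rw [div_mul_eq_mul_div, le_div_iff₀ hs]
      linarith
    refine h3.trans (mul_le_mul_of_nonneg_right ?_ (Real.sqrt_nonneg δ))
    linarith
  · have h1 : ‖F aδ - I₁δ‖ - δ * ‖w‖ ≤ δ * (1 + ‖w‖) := by
      refine le_of_sq_le_sq ?_ (by positivity)
      have : 0 ≤ δ * ((1 - C * ‖w‖) * ‖aδ - adag‖ ^ 2) := by positivity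
      linarith
    have h2 := mul_nonneg hq hδ.le
    linarith
end

section
/- Let X be a separable real Hilbert space, Y a real Hilbert space, M ⊆ X nonempty, and F : M → Y continuous and weakly sequentially closed. Let a₀ ∈ X and I₁ ∈ Y, let a† ∈ M be the unique a₀-minimum-norm solution of F(a) = I₁, and let ε > 2‖a† − a₀‖. Let (δₖ), (εₖ), (αₖ) be sequences of positive reals with δₖ → 0, εₖ → 0, αₖ → 0, δₖ²/αₖ → 0, and εₖ²/αₖ → 0 as k → ∞. Let I₁^{δₖ} ∈ Y satisfy ‖I₁ − I₁^{δₖ}‖ ≤ δₖ, let F_k : M → Y be maps with ‖F(a) − F_k(a)‖ ≤ εₖ for all a ∈ M with ‖a − a†‖ ≤ ε, and let aₖ ∈ M minimize a ↦ ‖F_k(a) − I₁^{δₖ}‖² + αₖ‖a − a₀‖² over M. Then aₖ → a† in the norm of X as k → ∞. -/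
open Filter Topology RealInnerProductSpace

/-- A bounded sequence in a separable Hilbert space has a weakly convergent subsequence. -/
theorem exists_subseq_tendsto_inner {X : Type*} [NormedAddCommGroup X] [InnerProductSpace ℝ X]
    [CompleteSpace X] [TopologicalSpace.SeparableSpace X] (u : ℕ → X) (R : ℝ)
    (hu : ∀ n, ‖u n‖ ≤ R) :
    ∃ x : X, ∃ φ : ℕ → ℕ, StrictMono φ ∧
      ∀ z : X, Tendsto (fun n => ⟪u (φ n), z⟫) atTop (𝓝 ⟪x, z⟫) := by
  obtain ⟨f, -, φ, hφ, hf⟩ := WeakDual.isSeqCompact_closedBall ℝ X 0 R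
    (x := fun n => StrongDual.toWeakDual (InnerProductSpace.toDual ℝ X (u n))) (fun n => by
      simpa using hu n)
  refine ⟨(InnerProductSpace.toDual ℝ X).symm (WeakDual.toStrongDual f), φ, hφ, fun z => ?_⟩
  rw [InnerProductSpace.toDual_symm_apply]
  exact ((WeakDual.eval_continuous z).tendsto f).comp hf

/-- Weak convergence together with an asymptotic bound on the norms by the norm of the limit
implies norm convergence. -/
theorem tendsto_of_tendsto_inner_of_norm_sq_le {X : Type*} [NormedAddCommGroup X]
    [InnerProductSpace ℝ X] {u : ℕ → X} {x c : X} {s : ℕ → ℝ}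
    (hweak : ∀ z : X, Tendsto (fun n => ⟪u n, z⟫) atTop (𝓝 ⟪x, z⟫))
    (hs : Tendsto s atTop (𝓝 (‖x - c‖ ^ 2))) (hle : ∀ n, ‖u n - c‖ ^ 2 ≤ s n) :
    Tendsto u atTop (𝓝 x) := by
  have hinner : Tendsto (fun n => ⟪u n - c, x - c⟫) atTop (𝓝 (‖x - c‖ ^ 2)) := by
    simpa only [inner_sub_left, ← real_inner_self_eq_norm_sq] using
      (hweak (x - c)).sub_const ⟪c, x - c⟫
  have hbound : ∀ n, ‖u n - x‖ ^ 2 ≤ s n - 2 * ⟪u n - c, x - c⟫ + ‖x - c‖ ^ 2 := fun n => by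
    rw [← sub_sub_sub_cancel_right (u n) x c, norm_sub_sq_real]
    linarith [hle n]
  have hlim := (hs.sub (hinner.const_mul 2)).add_const (‖x - c‖ ^ 2)
  have hsq : Tendsto (fun n => ‖u n - x‖ ^ 2) atTop (𝓝 0) :=
    squeeze_zero (fun n => sq_nonneg _) hbound (by convert hlim using 2; ring)
  rw [tendsto_iff_norm_sub_tendsto_zero]
  simpa [Real.sqrt_sq] using hsq.sqrt

/-- Asymptotic bounds on squared norms pass to weak limits. -/
theorem norm_sub_le_of_tendsto_inner {X : Type*} [NormedAddCommGroup X]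
    [InnerProductSpace ℝ X] {u : ℕ → X} {x c : X} {s : ℕ → ℝ} {r : ℝ} (hr : 0 ≤ r)
    (hweak : ∀ z : X, Tendsto (fun n => ⟪u n, z⟫) atTop (𝓝 ⟪x, z⟫))
    (hs : Tendsto s atTop (𝓝 (r ^ 2))) (hle : ∀ n, ‖u n - c‖ ^ 2 ≤ s n) :
    ‖x - c‖ ≤ r := by
  have hinner : Tendsto (fun n => ⟪u n - c, x - c⟫) atTop (𝓝 (‖x - c‖ ^ 2)) := by
    simpa only [inner_sub_left, ← real_inner_self_eq_norm_sq] using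
      (hweak (x - c)).sub_const ⟪c, x - c⟫
  have hbound : ∀ n, 2 * ⟪u n - c, x - c⟫ - ‖x - c‖ ^ 2 ≤ s n := fun n => by
    have h := sq_nonneg ‖(u n - c) - (x - c)‖
    rw [norm_sub_sq_real] at h
    linarith [hle n]
  have h := le_of_tendsto_of_tendsto' ((hinner.const_mul 2).sub_const (‖x - c‖ ^ 2)) hs hbound
  exact (sq_le_sq₀ (norm_nonneg _) hr).1 (by linarith)

/-- Convergence of Tikhonov regularization (IIM, full noise case):
with noisy data `I₁^{δₖ}` (noise level `δₖ`), noisy operators `Fₖ` with uniform operator-noise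
level `εₖ` on the ball of radius `ε > 2‖a† - a₀‖` around the unique `a₀`-minimum-norm solution
`a†`, and parameters `αₖ → 0` with `δₖ²/αₖ → 0` and `εₖ²/αₖ → 0`, the Tikhonov minimizers
converge to `a†` in norm. -/
theorem iim_tikhonov_convergence_full_noise
    {X Y : Type*}
    [NormedAddCommGroup X] [InnerProductSpace ℝ X] [CompleteSpace X]
    [TopologicalSpace.SeparableSpace X]
    [NormedAddCommGroup Y] [InnerProductSpace ℝ Y] [CompleteSpace Y]
    (M : Set X) (hM : M.Nonempty)
    (F : X → Y) (hFcont : ContinuousOn F M)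
    (hFwsc : ∀ (b : ℕ → X), (∀ n, b n ∈ M) → ∀ (x : X) (y : Y),
      (∀ z : X, Tendsto (fun n => ⟪b n, z⟫) atTop (𝓝 ⟪x, z⟫)) →
      (∀ z : Y, Tendsto (fun n => ⟪F (b n), z⟫) atTop (𝓝 ⟪y, z⟫)) →
      x ∈ M ∧ F x = y)
    (a₀ : X) (I₁ : Y) (adag : X)
    (hadagMNS : adag ∈ M ∧ F adag = I₁ ∧
      ∀ b ∈ M, F b = I₁ → ‖adag - a₀‖ ≤ ‖b - a₀‖)
    (huniq : ∀ b : X, (b ∈ M ∧ F b = I₁ ∧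
      ∀ c ∈ M, F c = I₁ → ‖b - a₀‖ ≤ ‖c - a₀‖) → b = adag)
    (ε : ℝ) (hε : 2 * ‖adag - a₀‖ < ε)
    (δ εop α : ℕ → ℝ)
    (hδpos : ∀ k, 0 < δ k) (hεpos : ∀ k, 0 < εop k) (hαpos : ∀ k, 0 < α k)
    (hδ0 : Tendsto δ atTop (𝓝 0)) (hεop0 : Tendsto εop atTop (𝓝 0))
    (hα0 : Tendsto α atTop (𝓝 0))
    (hδratio : Tendsto (fun k => (δ k) ^ 2 / α k) atTop (𝓝 0))
    (hεratio : Tendsto (fun k => (εop k) ^ 2 / α k) atTop (𝓝 0))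
    (I₁δ : ℕ → Y) (hnoise : ∀ k, ‖I₁ - I₁δ k‖ ≤ δ k)
    (Fk : ℕ → X → Y)
    (hopnoise : ∀ k, ∀ b ∈ M, ‖b - adag‖ ≤ ε → ‖F b - Fk k b‖ ≤ εop k)
    (a : ℕ → X) (hamem : ∀ k, a k ∈ M)
    (hmin : ∀ k, ∀ b ∈ M,
      ‖Fk k (a k) - I₁δ k‖ ^ 2 + α k * ‖a k - a₀‖ ^ 2 ≤
        ‖Fk k b - I₁δ k‖ ^ 2 + α k * ‖b - a₀‖ ^ 2) :
    Tendsto a atTop (𝓝 adag) := by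
  obtain ⟨hmem, hFa, hmns⟩ := hadagMNS
  set r := ‖adag - a₀‖
  have hr0 : 0 ≤ r := norm_nonneg _
  set s : ℕ → ℝ := fun k => 2 * ((εop k) ^ 2 / α k) + 2 * ((δ k) ^ 2 / α k) + r ^ 2 with hs_def
  have hs : Tendsto s atTop (𝓝 (r ^ 2)) := by
    simpa using ((hεratio.const_mul 2).add (hδratio.const_mul 2)).add_const (r ^ 2)
  have hfun : ∀ k, ‖Fk k (a k) - I₁δ k‖ ^ 2 + α k * ‖a k - a₀‖ ^ 2 ≤ α k * s k := fun k => by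
    have hop := hopnoise k adag hmem (by simpa using (by linarith : 0 ≤ ε))
    rw [hFa, norm_sub_rev] at hop
    have htri : ‖Fk k adag - I₁δ k‖ ≤ εop k + δ k :=
      (norm_sub_le_norm_sub_add_norm_sub _ I₁ _).trans (add_le_add hop (hnoise k))
    have hsq : ‖Fk k adag - I₁δ k‖ ^ 2 ≤ (εop k + δ k) ^ 2 :=
      pow_le_pow_left₀ (norm_nonneg _) htri 2
    have hα := (hαpos k).ne'
    have hexp : α k * s k = 2 * εop k ^ 2 + 2 * δ k ^ 2 + α k * r ^ 2 := by
      simp only [hs_def]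
      field_simp
    rw [hexp]
    nlinarith [hmin k adag hmem, sq_nonneg (εop k - δ k)]
  have hle : ∀ k, ‖a k - a₀‖ ^ 2 ≤ s k := fun k =>
    le_of_mul_le_mul_left (by nlinarith [hfun k, sq_nonneg ‖Fk k (a k) - I₁δ k‖]) (hαpos k)
  have hres : Tendsto (fun k => ‖Fk k (a k) - I₁δ k‖) atTop (𝓝 0) := by
    have hsq : Tendsto (fun k => ‖Fk k (a k) - I₁δ k‖ ^ 2) atTop (𝓝 0) :=
      squeeze_zero (fun k => sq_nonneg _)
        (fun k => (le_add_of_nonneg_right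
          (mul_nonneg (hαpos k).le (sq_nonneg ‖a k - a₀‖))).trans (hfun k))
        (by simpa using hα0.mul hs)
    simpa [Real.sqrt_sq] using hsq.sqrt
  have hball : ∀ᶠ k in atTop, ‖a k - adag‖ ≤ ε := by
    filter_upwards [hs.eventually_lt_const (show r ^ 2 < (ε - r) ^ 2 by nlinarith)] with k hk
    have h : ‖a k - a₀‖ ≤ ε - r :=
      (sq_le_sq₀ (norm_nonneg _) (by linarith)).1 ((hle k).trans hk.le)
    have htri := norm_sub_le_norm_sub_add_norm_sub (a k) a₀ adag
    rw [norm_sub_rev a₀ adag] at htri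
    linarith
  have hF : Tendsto (fun k => F (a k)) atTop (𝓝 I₁) := by
    rw [tendsto_iff_norm_sub_tendsto_zero]
    refine squeeze_zero' (Eventually.of_forall fun k => norm_nonneg _) ?_
      (by simpa using (hεop0.add hres).add hδ0)
    filter_upwards [hball] with k hk
    have hop := hopnoise k (a k) (hamem k) hk
    have htri₁ := norm_sub_le_norm_sub_add_norm_sub (F (a k)) (I₁δ k) I₁
    have htri₂ := norm_sub_le_norm_sub_add_norm_sub (F (a k)) (Fk k (a k)) (I₁δ k)
    have hdata := hnoise k
    rw [norm_sub_rev] at hdata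
    linarith
  obtain ⟨B, hB⟩ := hs.bddAbove_range
  have hbdd : ∀ k, ‖a k‖ ≤ √B + ‖a₀‖ := fun k => by
    have h := Real.le_sqrt_of_sq_le ((hle k).trans (hB ⟨k, rfl⟩))
    linarith [norm_le_norm_sub_add (a k) a₀]
  refine tendsto_of_subseq_tendsto fun ns hns => ?_
  obtain ⟨x, φ, hφ, hweak⟩ :=
    exists_subseq_tendsto_inner (fun n => a (ns n)) _ (fun n => hbdd (ns n))
  have hsub : Tendsto (fun n => ns (φ n)) atTop atTop := hns.comp hφ.tendsto_atTop
  obtain ⟨hxM, hFx⟩ := hFwsc (fun n => a (ns (φ n))) (fun n => hamem _) x I₁ hweak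
    (fun z => (hF.comp hsub).inner tendsto_const_nhds)
  have hxle : ‖x - a₀‖ ≤ r :=
    norm_sub_le_of_tendsto_inner hr0 hweak (hs.comp hsub) (fun n => hle _)
  obtain rfl : x = adag := huniq x ⟨hxM, hFx, fun c hc hFc => hxle.trans (hmns c hc hFc)⟩
  exact ⟨φ, tendsto_of_tendsto_inner_of_norm_sq_le hweak (hs.comp hsub) (fun n => hle _)⟩
end

section
/- Let X and Y be real Hilbert spaces, M ⊆ X nonempty closed and convex, and F : X → Y continuously Fréchet differentiable. Let a₀ ∈ X, I₁ ∈ Y, and let a† ∈ M be an a₀-minimum-norm solution of F(a) = I₁. Suppose there are ε > 2‖a† − a₀‖ and C > 0 such that ‖F′(a†) − F′(a)‖_{op} ≤ C‖a† − a‖ for all a ∈ M with ‖a − a†‖ ≤ ε, and suppose there exists w ∈ Y with a† − a₀ = F′(a†)* w and C‖w‖ < 1. Let c ≥ 0. Then there exist K > 0 and δ₀ > 0 such that for every δ ∈ (0, δ₀], every I₁^δ ∈ Y with ‖I₁ − I₁^δ‖ ≤ δ, every map F^δ : M → Y with ‖F(a) − F^δ(a)‖ ≤ cδ for all a ∈ M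 with ‖a − a†‖ ≤ ε, and every minimizer a_δ ∈ M of a ↦ ‖F^δ(a) − I₁^δ‖² + δ‖a − a₀‖² over M (regularization parameter α = δ), one has ‖a_δ − a†‖ ≤ K√δ. -/
/-- If the derivative of `F` along the segment from `a` to `b` is Lipschitz at `a` with
constant `C`, the linearization error of `F` at `a` is at most `C / 2 * ‖b - a‖ ^ 2`. -/
lemma norm_sub_sub_fderiv_le_of_lipschitz_segment
    {X Y : Type*} [NormedAddCommGroup X] [NormedSpace ℝ X]
    [NormedAddCommGroup Y] [NormedSpace ℝ Y]
    {F : X → Y} {F' : X → X →L[ℝ] Y} (hF : ∀ x, HasFDerivAt F (F' x) x) {a b : X} {C : ℝ}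
    (hLip : ∀ t ∈ Set.Icc (0 : ℝ) 1,
      ‖F' a - F' (a + t • (b - a))‖ ≤ C * ‖a - (a + t • (b - a))‖) :
    ‖F b - F a - F' a (b - a)‖ ≤ C / 2 * ‖b - a‖ ^ 2 := by
  have hd (t : ℝ) : HasDerivAt (fun t : ℝ => F (a + t • (b - a)) - F a - t • F' a (b - a))
      (F' (a + t • (b - a)) (b - a) - F' a (b - a)) t := by
    have hline : HasDerivAt (fun t : ℝ => a + t • (b - a)) (b - a) t := by
      simpa using ((hasDerivAt_id t).smul_const (b - a)).const_add a
    have hlin : HasDerivAt (fun t : ℝ => t • F' a (b - a)) (F' a (b - a)) t := by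
      simpa using (hasDerivAt_id t).smul_const (F' a (b - a))
    exact (((hF _).comp_hasDerivAt t hline).sub_const (F a)).sub hlin
  have hB (t : ℝ) : HasDerivAt (fun t : ℝ => C / 2 * ‖b - a‖ ^ 2 * t ^ 2)
      (C * t * ‖b - a‖ ^ 2) t := by
    refine ((hasDerivAt_pow 2 t).const_mul (C / 2 * ‖b - a‖ ^ 2)).congr_deriv ?_
    norm_num
    ring
  have h := image_norm_le_of_norm_deriv_right_le_deriv_boundary
    (f := fun t : ℝ => F (a + t • (b - a)) - F a - t • F' a (b - a)) (a := 0) (b := 1)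
    (fun t _ => (hd t).continuousAt.continuousWithinAt)
    (fun t _ => (hd t).hasDerivWithinAt) (by simp) hB
    (fun t ht => ?_) (Set.right_mem_Icc.2 zero_le_one)
  · simpa using h
  · calc ‖F' (a + t • (b - a)) (b - a) - F' a (b - a)‖
        = ‖(F' a - F' (a + t • (b - a))) (b - a)‖ := by
          rw [norm_sub_rev, sub_apply]
      _ ≤ ‖F' a - F' (a + t • (b - a))‖ * ‖b - a‖ := ContinuousLinearMap.le_opNorm _ _
      _ ≤ C * ‖a - (a + t • (b - a))‖ * ‖b - a‖ := by
          gcongr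
          exact hLip t ⟨ht.1, ht.2.le⟩
      _ = C * t * ‖b - a‖ ^ 2 := by
          rw [sub_add_cancel_left, norm_neg, norm_smul, Real.norm_of_nonneg ht.1]
          ring

/-- Convergence rates for Tikhonov regularization (IIM, full noise case):
under the source condition `a† - a₀ = F'(a†)* w` with `C‖w‖ < 1`, a Lipschitz bound on the
Fréchet derivative near `a†`, operator-noise of size `c·δ` on the ball of radius
`ε > 2‖a† - a₀‖` around `a†`, and parameter choice `α = δ`, Tikhonov minimizers of the noisy
functional satisfy `‖a_δ - a†‖ ≤ K√δ`. -/
theorem iim_tikhonov_rates_full_noise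
    {X Y : Type*}
    [NormedAddCommGroup X] [InnerProductSpace ℝ X] [CompleteSpace X]
    [NormedAddCommGroup Y] [InnerProductSpace ℝ Y] [CompleteSpace Y]
    (M : Set X) (hM : M.Nonempty) (hMclosed : IsClosed M) (hMconvex : Convex ℝ M)
    (F : X → Y) (F' : X → X →L[ℝ] Y)
    (hFderiv : ∀ x, HasFDerivAt F (F' x) x) (hF'cont : Continuous F')
    (a₀ : X) (I₁ : Y) (adag : X)
    (hadagmem : adag ∈ M) (hsol : F adag = I₁)
    (hMNS : ∀ b ∈ M, F b = I₁ → ‖adag - a₀‖ ≤ ‖b - a₀‖)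
    (ε C : ℝ) (hε : 2 * ‖adag - a₀‖ < ε) (hC : 0 < C)
    (hLip : ∀ b ∈ M, ‖b - adag‖ ≤ ε → ‖F' adag - F' b‖ ≤ C * ‖adag - b‖)
    (w : Y) (hsource : adag - a₀ = (F' adag).adjoint w) (hsmall : C * ‖w‖ < 1)
    (c : ℝ) (hc : 0 ≤ c) :
    ∃ K > 0, ∃ δ₀ > 0, ∀ δ : ℝ, 0 < δ → δ ≤ δ₀ →
      ∀ I₁δ : Y, ‖I₁ - I₁δ‖ ≤ δ →
      ∀ Fδ : X → Y, (∀ b ∈ M, ‖b - adag‖ ≤ ε → ‖F b - Fδ b‖ ≤ c * δ) →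
      ∀ aδ ∈ M,
        (∀ b ∈ M, ‖Fδ aδ - I₁δ‖ ^ 2 + δ * ‖aδ - a₀‖ ^ 2 ≤
          ‖Fδ b - I₁δ‖ ^ 2 + δ * ‖b - a₀‖ ^ 2) →
        ‖aδ - adag‖ ≤ K * Real.sqrt δ := by
  have hD : 0 ≤ ‖adag - a₀‖ := norm_nonneg _
  have hq : 0 < 1 - C * ‖w‖ := by linarith
  have hw : 0 ≤ ‖w‖ := norm_nonneg _
  have hgap : 0 < ε * (ε - 2 * ‖adag - a₀‖) := mul_pos (by linarith) (by linarith)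
  refine ⟨(c + 1 + ‖w‖) / √(1 - C * ‖w‖), by positivity,
    ε * (ε - 2 * ‖adag - a₀‖) / (c + 1) ^ 2, by positivity, ?_⟩
  intro δ hδ hδ₀ I₁δ hI Fδ hFδ aδ haδ hmin
  rw [le_div_iff₀ (by positivity)] at hδ₀
  have hdata : ‖Fδ adag - I₁δ‖ ≤ (c + 1) * δ := by
    have h₁ := hFδ adag hadagmem (by simp; linarith)
    rw [hsol, norm_sub_rev] at h₁
    have h₂ := norm_sub_le_norm_sub_add_norm_sub (Fδ adag) I₁ I₁δ
    linarith
  have hcomp : ‖Fδ aδ - I₁δ‖ ^ 2 + δ * ‖aδ - a₀‖ ^ 2 ≤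
      ((c + 1) * δ) ^ 2 + δ * ‖adag - a₀‖ ^ 2 := by
    have := pow_le_pow_left₀ (norm_nonneg _) hdata 2
    linarith [hmin adag hadagmem]
  have hball : ‖aδ - adag‖ ≤ ε := by
    have hsq : ‖aδ - a₀‖ ^ 2 ≤ (ε - ‖adag - a₀‖) ^ 2 := by
      refine le_of_mul_le_mul_left ?_ hδ
      nlinarith [mul_le_mul_of_nonneg_left hδ₀ hδ.le, sq_nonneg ‖Fδ aδ - I₁δ‖]
    have h₁ := (sq_le_sq₀ (norm_nonneg _) (by linarith)).1 hsq
    have h₂ := norm_sub_le_norm_sub_add_norm_sub aδ a₀ adag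
    rw [norm_sub_rev a₀ adag] at h₂
    linarith
  have hrem : ‖F aδ - F adag - F' adag (aδ - adag)‖ ≤ C / 2 * ‖aδ - adag‖ ^ 2 := by
    refine norm_sub_sub_fderiv_le_of_lipschitz_segment hFderiv fun t ht =>
      hLip _ (hMconvex.add_smul_sub_mem hadagmem haδ ht) ?_
    rw [add_sub_cancel_left, norm_smul, Real.norm_of_nonneg ht.1]
    exact (mul_le_of_le_one_left (norm_nonneg _) ht.2).trans hball
  have hres : ‖F aδ - F adag‖ ≤ (c + 1) * δ + ‖Fδ aδ - I₁δ‖ := by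
    have h₁ := norm_sub_le_norm_sub_add_norm_sub (F aδ) (Fδ aδ) (F adag)
    have h₂ := norm_sub_le_norm_sub_add_norm_sub (Fδ aδ) I₁δ (F adag)
    rw [hsol] at h₁ h₂ ⊢
    rw [norm_sub_rev I₁δ] at h₂
    linarith [hFδ aδ haδ hball]
  have hlin : ‖F' adag (aδ - adag)‖ ≤
      (c + 1) * δ + ‖Fδ aδ - I₁δ‖ + C / 2 * ‖aδ - adag‖ ^ 2 := by
    have := norm_sub_le (F aδ - F adag) (F aδ - F adag - F' adag (aδ - adag))
    rw [sub_sub_cancel] at this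
    linarith
  have hinner : -(‖w‖ * ‖F' adag (aδ - adag)‖) ≤ inner ℝ (aδ - adag) (adag - a₀) := by
    rw [hsource, ContinuousLinearMap.adjoint_inner_right, mul_comm]
    exact neg_le_of_abs_le (abs_real_inner_le_norm _ _)
  have hexpand : ‖aδ - a₀‖ ^ 2 =
      ‖aδ - adag‖ ^ 2 + 2 * inner ℝ (aδ - adag) (adag - a₀) + ‖adag - a₀‖ ^ 2 := by
    rw [← norm_add_sq_real, sub_add_sub_cancel]
  have herr : (1 - C * ‖w‖) * ‖aδ - adag‖ ^ 2 ≤ (c + 1 + ‖w‖) ^ 2 * δ := by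
    refine le_of_mul_le_mul_left ?_ hδ
    have h₁ := mul_le_mul_of_nonneg_left hlin hw
    have h₂ : -(‖w‖ * ((c + 1) * δ + ‖Fδ aδ - I₁δ‖ + C / 2 * ‖aδ - adag‖ ^ 2)) ≤
        inner ℝ (aδ - adag) (adag - a₀) := by linarith
    have h₃ := mul_le_mul_of_nonneg_left h₂ hδ.le
    rw [hexpand] at hcomp
    linarith [sq_nonneg (‖Fδ aδ - I₁δ‖ - δ * ‖w‖)]
  rw [div_mul_eq_mul_div, le_div_iff₀ (Real.sqrt_pos.2 hq)]
  refine (sq_le_sq₀ (by positivity) (by positivity)).1 ?_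
  rw [mul_pow, mul_pow, Real.sq_sqrt hq.le, Real.sq_sqrt hδ.le]
  linarith
end

section
/- Let X and Y be real Hilbert spaces, M ⊆ X nonempty closed and convex, and F : X → Y continuously Fréchet differentiable. Let a₀ ∈ X, I₁ ∈ Y, and let a† ∈ M be an a₀-minimum-norm solution of F(a) = I₁. Suppose there are ε > 2‖a† − a₀‖ and C > 0 such that ‖F′(a†) − F′(a)‖_{op} ≤ C‖a† − a‖ for all a ∈ M with ‖a − a†‖ ≤ ε, and suppose there exists w ∈ Y with a† − a₀ = F′(a†)* w and C‖w‖ < 1. Let c ≥ 0. Then there exist K > 0 and δ₀ > 0 such that for every δ ∈ (0, δ₀], every I₁^δ ∈ Y with ‖I₁ − I₁^δ‖ ≤ δ, every η with 0 ≤ η ≤ cδ², and every a_{δ,η} ∈ M satisfying ‖F(a_{δ,η}) − I₁^δ‖² + δ‖a_{δ,η} − a₀‖² ≤ ‖F(a) − I₁^δ‖² + δ‖a − a₀‖² + η for all a ∈ M (an η-approximate minimizer with regularization parameter α = δ), one has ‖a_{δ,η} − a†‖ ≤ K√δ. -/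
/-- First-order Taylor remainder bound on a convex set: the derivative only has to be
Lipschitz relative to the base point. -/
theorem Convex.norm_sub_sub_le_of_norm_fderiv_sub_le
    {E G : Type*} [NormedAddCommGroup E] [NormedSpace ℝ E]
    [NormedAddCommGroup G] [NormedSpace ℝ G]
    {s : Set E} (hs : Convex ℝ s) {f : E → G} {f' : E → E →L[ℝ] G}
    (hf : ∀ x ∈ s, HasFDerivAt f (f' x) x) {C : ℝ} {x y : E}
    (hbound : ∀ z ∈ s, ‖f' x - f' z‖ ≤ C * ‖x - z‖)
    (hx : x ∈ s) (hy : y ∈ s) :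
    ‖f y - f x - f' x (y - x)‖ ≤ C / 2 * ‖y - x‖ ^ 2 := by
  have hmem : ∀ t ∈ Set.Icc (0 : ℝ) 1, x + t • (y - x) ∈ s := fun t ht =>
    hs.add_smul_sub_mem hx hy ht
  have hline : ∀ t : ℝ, HasDerivAt (fun t : ℝ => x + t • (y - x)) (y - x) t := fun t => by
    simpa using ((hasDerivAt_id t).smul_const (y - x)).const_add x
  have hderiv : ∀ t ∈ Set.Icc (0 : ℝ) 1,
      HasDerivAt (fun t : ℝ => f (x + t • (y - x)) - f x - t • f' x (y - x))
        (f' (x + t • (y - x)) (y - x) - f' x (y - x)) t := fun t ht => by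
    simpa only [id, one_smul, Function.comp_apply] using
      (((hf _ (hmem t ht)).comp_hasDerivAt t (hline t)).sub_const (f x)).fun_sub
        ((hasDerivAt_id t).smul_const (f' x (y - x)))
  have hB : ∀ t : ℝ, HasDerivAt (fun t : ℝ => C / 2 * ‖y - x‖ ^ 2 * t ^ 2)
      (C * ‖y - x‖ ^ 2 * t) t := fun t => by
    refine ((hasDerivAt_pow 2 t).const_mul (C / 2 * ‖y - x‖ ^ 2)).congr_deriv ?_
    push_cast
    ring
  have key := image_norm_le_of_norm_deriv_right_le_deriv_boundary
    (fun t ht => (hderiv t ht).continuousAt.continuousWithinAt)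
    (fun t ht => (hderiv t (Set.Ico_subset_Icc_self ht)).hasDerivWithinAt)
    (by simp) hB
    (fun t ht => by
      rw [← sub_apply]
      have hz := hbound _ (hmem t (Set.Ico_subset_Icc_self ht))
      rw [norm_sub_rev, sub_add_cancel_left, norm_neg, norm_smul, Real.norm_of_nonneg ht.1] at hz
      calc _ ≤ _ * ‖y - x‖ := ContinuousLinearMap.le_opNorm _ _
        _ ≤ C * (t * ‖y - x‖) * ‖y - x‖ := by gcongr
        _ = C * ‖y - x‖ ^ 2 * t := by ring)
    (Set.right_mem_Icc.2 zero_le_one)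
  simpa using key


/-- Convergence rates for approximate Tikhonov minimization (IIM):
under the source condition `a† - a₀ = F'(a†)* w` with `C‖w‖ < 1` and a Lipschitz bound on
the Fréchet derivative near `a†`, any `η`-approximate minimizer of the Tikhonov functional
with parameter choice `α = δ` and tolerance `η ≤ c·δ²` still satisfies the order-optimal
rate `‖a_{δ,η} - a†‖ ≤ K√δ`. -/
theorem iim_tikhonov_rates_approximate_minimization
    {X Y : Type*}
    [NormedAddCommGroup X] [InnerProductSpace ℝ X] [CompleteSpace X]
    [NormedAddCommGroup Y] [InnerProductSpace ℝ Y] [CompleteSpace Y]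
    (M : Set X) (hM : M.Nonempty) (hMclosed : IsClosed M) (hMconvex : Convex ℝ M)
    (F : X → Y) (F' : X → X →L[ℝ] Y)
    (hFderiv : ∀ x, HasFDerivAt F (F' x) x) (hF'cont : Continuous F')
    (a₀ : X) (I₁ : Y) (adag : X)
    (hadagmem : adag ∈ M) (hsol : F adag = I₁)
    (hMNS : ∀ b ∈ M, F b = I₁ → ‖adag - a₀‖ ≤ ‖b - a₀‖)
    (ε C : ℝ) (hε : 2 * ‖adag - a₀‖ < ε) (hC : 0 < C)
    (hLip : ∀ b ∈ M, ‖b - adag‖ ≤ ε → ‖F' adag - F' b‖ ≤ C * ‖adag - b‖)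
    (w : Y) (hsource : adag - a₀ = (F' adag).adjoint w) (hsmall : C * ‖w‖ < 1)
    (c : ℝ) (hc : 0 ≤ c) :
    ∃ K > 0, ∃ δ₀ > 0, ∀ δ : ℝ, 0 < δ → δ ≤ δ₀ →
      ∀ I₁δ : Y, ‖I₁ - I₁δ‖ ≤ δ →
      ∀ η : ℝ, 0 ≤ η → η ≤ c * δ ^ 2 →
      ∀ aδη ∈ M,
        (∀ b ∈ M, ‖F aδη - I₁δ‖ ^ 2 + δ * ‖aδη - a₀‖ ^ 2 ≤
          ‖F b - I₁δ‖ ^ 2 + δ * ‖b - a₀‖ ^ 2 + η) →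
        ‖aδη - adag‖ ≤ K * Real.sqrt δ := by
  set d := adag - a₀ with hd
  have hd0 : 0 ≤ ‖d‖ := norm_nonneg d
  have hw0 : 0 ≤ ‖w‖ := norm_nonneg w
  have hq : 0 < 1 - C * ‖w‖ := by linarith
  have hN : 0 < 1 + c + 2 * ‖w‖ + ‖w‖ ^ 2 := by positivity
  have hgap : 0 < (ε - ‖d‖) ^ 2 - ‖d‖ ^ 2 := by nlinarith
  refine ⟨Real.sqrt ((1 + c + 2 * ‖w‖ + ‖w‖ ^ 2) / (1 - C * ‖w‖)), by positivity,
    ((ε - ‖d‖) ^ 2 - ‖d‖ ^ 2) / (1 + c), by positivity, ?_⟩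
  intro δ hδ hδ₀ I₁δ hI η _ hη x hx hmin
  have hmin' := hmin adag hadagmem
  rw [hsol, ← hd] at hmin'
  have hI2 : ‖I₁ - I₁δ‖ ^ 2 ≤ δ ^ 2 := by gcongr
  have hball : ‖x - adag‖ ≤ ε := by
    rw [le_div_iff₀ (by positivity)] at hδ₀
    have h1 : δ * ‖x - a₀‖ ^ 2 ≤ δ * (ε - ‖d‖) ^ 2 := by
      nlinarith [sq_nonneg ‖F x - I₁δ‖]
    have h2 : ‖x - a₀‖ ≤ ε - ‖d‖ :=
      le_of_sq_le_sq (le_of_mul_le_mul_left h1 hδ) (by linarith)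
    have h3 : ‖x - adag‖ ≤ ‖x - a₀‖ + ‖d‖ := by
      simpa [hd] using norm_sub_le (x - a₀) (adag - a₀)
    linarith
  have hrem : ‖F x - F adag - F' adag (x - adag)‖ ≤ C / 2 * ‖x - adag‖ ^ 2 :=
    (hMconvex.inter (convex_closedBall adag ε)).norm_sub_sub_le_of_norm_fderiv_sub_le
      (fun z _ => hFderiv z)
      (fun z hz => hLip z hz.1 (mem_closedBall_iff_norm.1 hz.2))
      ⟨hadagmem, Metric.mem_closedBall_self (by linarith)⟩
      ⟨hx, mem_closedBall_iff_norm.2 hball⟩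
  have hinner : inner ℝ d (x - adag) = inner ℝ w (F x - I₁δ) - inner ℝ w (I₁ - I₁δ)
      - inner ℝ w (F x - F adag - F' adag (x - adag)) := by
    rw [hsource, ContinuousLinearMap.adjoint_inner_left, ← inner_sub_right, ← inner_sub_right,
      hsol]
    congr 1
    abel
  have hr := neg_le_of_abs_le (abs_real_inner_le_norm w (F x - I₁δ))
  have hi := real_inner_le_norm w (I₁ - I₁δ)
  have hR := real_inner_le_norm w (F x - F adag - F' adag (x - adag))
  have hi' := mul_le_mul_of_nonneg_left hI hw0
  have hR' := mul_le_mul_of_nonneg_left hrem hw0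
  have hexp : ‖x - a₀‖ ^ 2 = ‖d‖ ^ 2 + 2 * inner ℝ d (x - adag) + ‖x - adag‖ ^ 2 := by
    rw [← norm_add_sq_real, hd, sub_add_sub_cancel']
  have hlow : -2 * inner ℝ d (x - adag) ≤
      2 * ‖w‖ * ‖F x - I₁δ‖ + 2 * ‖w‖ * δ + C * ‖w‖ * ‖x - adag‖ ^ 2 := by
    linarith
  have hmain : δ * ((1 - C * ‖w‖) * ‖x - adag‖ ^ 2) ≤
      δ * ((1 + c + 2 * ‖w‖ + ‖w‖ ^ 2) * δ) := by
    rw [hexp] at hmin'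
    linarith [mul_le_mul_of_nonneg_left hlow hδ.le, sq_nonneg (‖F x - I₁δ‖ - δ * ‖w‖)]
  rw [← Real.sqrt_mul (by positivity)]
  apply Real.le_sqrt_of_sq_le
  rw [div_mul_eq_mul_div, le_div_iff₀ hq, mul_comm]
  exact le_of_mul_le_mul_left hmain hδ
end
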